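/- Suppose f̃ is a continuous self-map of [-1,1] with unique turning point 0, f̃ maps 0 to 1 and maps −1 and 1 to −1, and the restrictions of f̃ to [-1,0] and to [0,1] are C¹-embeddings. Then for any γ > 1 the map f = h_γ^{−1} ∘ f̃ ∘ h_γ is a C¹ self-map of [-1,1] with power law |x|^γ at the critical point 0, and f'(−1) = (f̃'(−1))^γ and f'(1) = −|f̃'(1)|^γ. -/

import Mathlib

open Set MeasureTheory Filter Topology

noncomputable def len (s : Set ℝ) : ℝ := (volume s).toReal

noncomputable def branch (f : ℝ → ℝ) : Bool → ℝ → ℝ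
  | false => Function.invFunOn f (Icc (-1) 0)
  | true => Function.invFunOn f (Icc 0 1)

noncomputable def gw (f : ℝ → ℝ) : List Bool → ℝ → ℝ
  | [] => id
  | b :: w => branch f b ∘ gw f w

noncomputable def Iw (f : ℝ → ℝ) (w : List Bool) : Set ℝ := gw f w '' Icc (-1) 1

def word (a : ℕ → Bool) (n : ℕ) : List Bool := ((List.range (n + 1)).reverse).map a

noncomputable def ratio (f : ℝ → ℝ) (a : ℕ → Bool) (n : ℕ) : ℝ :=
  len (Iw f (word a n)) / len (Iw f ((word a n).dropLast))

def IsScalingFun (f : ℝ → ℝ) (s : (ℕ → Bool) → ℝ) : Prop :=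
  ∀ a : ℕ → Bool, Tendsto (ratio f a) atTop (nhds (s a))

def HolderOnDual (s : (ℕ → Bool) → ℝ) : Prop :=
  ∃ C > (0:ℝ), ∃ lam ∈ Ioo (0:ℝ) 1, ∀ a b : ℕ → Bool, ∀ n : ℕ,
    (∀ k < n, a k = b k) → |s a - s b| ≤ C * lam ^ n

def EvZero (a : ℕ → Bool) : Prop := ∃ N, ∀ n ≥ N, a n = false

def Lambda (f : ℝ → ℝ) : Set ℝ := {x | ∀ n : ℕ, f^[n] x ∈ Icc (-1) 1}

structure GoodFamily where
  eps0 : ℝ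
  eps0_pos : 0 < eps0
  f : ℝ → ℝ → ℝ
  f' : ℝ → ℝ → ℝ
  gamma : ℝ
  one_lt_gamma : 1 < gamma
  mono : ∀ ε ∈ Icc 0 eps0, StrictMonoOn (f ε) (Icc (-1) 0)
  anti : ∀ ε ∈ Icc 0 eps0, StrictAntiOn (f ε) (Icc 0 1)
  map_neg_one : ∀ ε ∈ Icc 0 eps0, f ε (-1) = -1
  map_one : ∀ ε ∈ Icc 0 eps0, f ε 1 = -1
  map_zero : ∀ ε ∈ Icc 0 eps0, f ε 0 = 1 + ε
  smooth : ContDiffOn ℝ 1 (fun p : ℝ × ℝ => f p.1 p.2) (Icc 0 eps0 ×ˢ Icc (-1) 1)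
  deriv_f : ∀ ε ∈ Icc 0 eps0, ∀ x ∈ Icc (-1:ℝ) 1,
    HasDerivWithinAt (f ε) (f' ε x) (Icc (-1) 1) x
  Rneg : ℝ → ℝ → ℝ
  Rpos : ℝ → ℝ → ℝ
  Rneg_cont : ContinuousOn (fun p : ℝ × ℝ => Rneg p.1 p.2) (Icc 0 eps0 ×ˢ Icc (-1) 0)
  Rpos_cont : ContinuousOn (fun p : ℝ × ℝ => Rpos p.1 p.2) (Icc 0 eps0 ×ˢ Icc 0 1)
  Rneg_ne : ∀ ε ∈ Icc 0 eps0, ∀ x ∈ Icc (-1:ℝ) 0, Rneg ε x ≠ 0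
  Rpos_ne : ∀ ε ∈ Icc 0 eps0, ∀ x ∈ Icc (0:ℝ) 1, Rpos ε x ≠ 0
  Rneg_eq : ∀ ε ∈ Icc 0 eps0, ∀ x ∈ Ico (-1:ℝ) 0, Rneg ε x = f' ε x / |x| ^ (gamma - 1)
  Rpos_eq : ∀ ε ∈ Icc 0 eps0, ∀ x ∈ Ioc (0:ℝ) 1, Rpos ε x = f' ε x / |x| ^ (gamma - 1)
  K' : ℝ
  K'_pos : 0 < K'
  alpha' : ℝ
  alpha'_mem : alpha' ∈ Ioc (0:ℝ) 1
  holder' : ∀ ε ∈ Icc 0 eps0, ∀ x ∈ Icc (-1:ℝ) 1, ∀ y ∈ Icc (-1:ℝ) 1,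
    |f' ε x - f' ε y| ≤ K' * |x - y| ^ alpha'
  K'' : ℝ
  K''_pos : 0 < K''
  alpha'' : ℝ
  alpha''_mem : alpha'' ∈ Ioc (0:ℝ) 1
  holder''_neg : ∀ ε ∈ Icc 0 eps0, ∀ x ∈ Ico (-1:ℝ) 0, ∀ y ∈ Ico (-1:ℝ) 0,
    |f' ε x / |x| ^ (gamma - 1) - f' ε y / |y| ^ (gamma - 1)| ≤ K'' * |x - y| ^ alpha''
  holder''_pos : ∀ ε ∈ Icc 0 eps0, ∀ x ∈ Ioc (0:ℝ) 1, ∀ y ∈ Ioc (0:ℝ) 1,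
    |f' ε x / |x| ^ (gamma - 1) - f' ε y / |y| ^ (gamma - 1)| ≤ K'' * |x - y| ^ alpha''
  C0 : ℝ
  C0_pos : 0 < C0
  lam : ℝ
  lam_mem : lam ∈ Ioo (0:ℝ) 1
  decay : ∀ ε ∈ Icc 0 eps0, ∀ n : ℕ, 1 ≤ n → ∀ w : List Bool, w.length = n + 1 →
    len (Iw (f ε) w) ≤ C0 * lam ^ n

/-- The change of coordinate `h_γ` associated to the singular metric
`dy = dx/(1-x²)^{(γ-1)/γ}` on `[-1,1]`. -/
noncomputable def hgam (γ : ℝ) (x : ℝ) : ℝ :=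
  -1 + (2 / ∫ t in (-1:ℝ)..1, ((1 - t ^ 2) ^ ((γ - 1) / γ))⁻¹) *
    ∫ t in (-1:ℝ)..x, ((1 - t ^ 2) ^ ((γ - 1) / γ))⁻¹

/-- The inverse of `h_γ` on `[-1,1]`. -/
noncomputable def hgamInv (γ : ℝ) : ℝ → ℝ := Function.invFunOn (hgam γ) (Icc (-1) 1)

lemma IsCompact.continuousOn_invFunOn_image {f : ℝ → ℝ} {s : Set ℝ} (hs : IsCompact s)
    (hf : ContinuousOn f s) (hinj : InjOn f s) :
    ContinuousOn (Function.invFunOn f s) (f '' s) := by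
  rw [continuousOn_iff_isClosed]
  intro C hC
  refine ⟨f '' (s ∩ C),
    ((hs.inter_right hC).image_of_continuousOn (hf.mono inter_subset_left)).isClosed, ?_⟩
  ext y
  constructor
  · rintro ⟨hy, x, hx, rfl⟩
    rw [mem_preimage, hinj.leftInvOn_invFunOn hx] at hy
    exact ⟨⟨x, ⟨hx, hy⟩, rfl⟩, x, hx, rfl⟩
  · rintro ⟨⟨x, ⟨hx, hxC⟩, rfl⟩, hy⟩
    refine ⟨?_, hy⟩
    rwa [mem_preimage, hinj.leftInvOn_invFunOn hx]

/-- A continuous function on `[a, b]` whose derivative on `(a, b)` extends continuously to `[a, b]`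
is differentiable up to the endpoints. -/
lemma hasDerivWithinAt_Icc_of_continuousOn {a b : ℝ} (hab : a < b) {f f' : ℝ → ℝ}
    (hf : ContinuousOn f (Icc a b)) (hf' : ContinuousOn f' (Icc a b))
    (hderiv : ∀ x ∈ Ioo a b, HasDerivAt f (f' x) x) :
    ∀ x ∈ Icc a b, HasDerivWithinAt f (f' x) (Icc a b) x := by
  intro x hx
  have hdiff : DifferentiableOn ℝ f (Ioo a b) := fun y hy =>
    (hderiv y hy).differentiableAt.differentiableWithinAt
  rcases eq_or_lt_of_le hx.1 with rfl | hax
  · refine (hasDerivWithinAt_Ici_of_tendsto_deriv hdiff ((hf a hx).mono Ioo_subset_Icc_self)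
      (Ioo_mem_nhdsGT hab) ?_).mono Icc_subset_Ici_self
    have : Tendsto f' (𝓝[Ioo a b] a) (𝓝 (f' a)) := (hf' a hx).mono Ioo_subset_Icc_self
    rw [nhdsWithin_Ioo_eq_nhdsGT hab] at this
    refine this.congr' ?_
    filter_upwards [Ioo_mem_nhdsGT hab] with y hy using (hderiv y hy).deriv.symm
  rcases eq_or_lt_of_le hx.2 with rfl | hxb
  · refine (hasDerivWithinAt_Iic_of_tendsto_deriv hdiff ((hf x hx).mono Ioo_subset_Icc_self)
      (Ioo_mem_nhdsLT hab) ?_).mono Icc_subset_Iic_self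
    have : Tendsto f' (𝓝[Ioo a x] x) (𝓝 (f' x)) := (hf' x hx).mono Ioo_subset_Icc_self
    rw [nhdsWithin_Ioo_eq_nhdsLT hab] at this
    refine this.congr' ?_
    filter_upwards [Ioo_mem_nhdsLT hab] with y hy using (hderiv y hy).deriv.symm
  exact (hderiv x ⟨hax, hxb⟩).hasDerivWithinAt

/-- The reciprocal of the density of the singular metric. -/
noncomputable def wgam (γ t : ℝ) : ℝ := (1 - t ^ 2) ^ ((γ - 1) / γ)

/-- The normalising constant of `hgam`. -/
noncomputable def bgam (γ : ℝ) : ℝ := 2 / ∫ t in (-1:ℝ)..1, (wgam γ t)⁻¹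

lemma hgam_eq (γ x : ℝ) : hgam γ x = -1 + bgam γ * ∫ t in (-1:ℝ)..x, (wgam γ t)⁻¹ := rfl

lemma wgam_neg (γ t : ℝ) : wgam γ (-t) = wgam γ t := by simp [wgam]

lemma wgam_pos {γ t : ℝ} (ht : t ∈ Ioo (-1:ℝ) 1) : 0 < wgam γ t :=
  Real.rpow_pos_of_pos (by nlinarith [ht.1, ht.2]) _

lemma wgam_zero (γ : ℝ) : wgam γ 0 = 1 := by simp [wgam]

lemma wgam_one {γ : ℝ} (hγ : 1 < γ) : wgam γ 1 = 0 := by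
  have : (γ - 1) / γ ≠ 0 := (div_pos (by linarith) (by linarith)).ne'
  simp [wgam, this]

lemma continuous_wgam {γ : ℝ} (hγ : 1 < γ) : Continuous (wgam γ) := by
  have : 0 ≤ (γ - 1) / γ := (div_pos (by linarith) (by linarith)).le
  unfold wgam
  exact (by fun_prop : Continuous fun t : ℝ => 1 - t ^ 2).rpow_const fun _ => Or.inr this

lemma wgam_eq_mul {γ t : ℝ} (ht : t ∈ Icc (-1:ℝ) 1) :
    wgam γ t = (1 + t) ^ ((γ - 1) / γ) * (1 - t) ^ ((γ - 1) / γ) := by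
  rw [wgam, ← Real.mul_rpow (by linarith [ht.1]) (by linarith [ht.2])]
  ring_nf

lemma intervalIntegrable_inv_wgam {γ : ℝ} (hγ : 1 < γ) :
    IntervalIntegrable (fun t => (wgam γ t)⁻¹) volume (-1) 1 := by
  have hleft : IntervalIntegrable (fun t => (wgam γ t)⁻¹) volume (-1) 0 := by
    have h1 : IntervalIntegrable (fun t : ℝ => t ^ (-((γ - 1) / γ))) volume 0 1 :=
      intervalIntegral.intervalIntegrable_rpow' (by
        rw [neg_lt_neg_iff, div_lt_one (by linarith)]; linarith)
    have h2 : IntervalIntegrable (fun t : ℝ => (1 + t) ^ (-((γ - 1) / γ))) volume (-1) 0 := by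
      have := h1.comp_add_left 1
      norm_num at this
      exact this
    have h3 : ContinuousOn (fun t : ℝ => (1 - t) ^ (-((γ - 1) / γ))) (uIcc (-1) 0) := by
      refine ContinuousOn.rpow_const (by fun_prop) fun t ht => Or.inl ?_
      rw [uIcc_of_le (by norm_num)] at ht
      linarith [ht.2]
    refine (h2.mul_continuousOn h3).congr fun t ht => ?_
    rw [uIoc_of_le (by norm_num)] at ht
    rw [wgam_eq_mul ⟨ht.1.le, by linarith [ht.2]⟩, mul_inv, Real.rpow_neg (by linarith [ht.1]),
      Real.rpow_neg (by linarith [ht.2])]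
  refine hleft.trans ?_
  rw [IntervalIntegrable.iff_comp_neg]
  simpa [wgam_neg] using hleft.symm

lemma integral_inv_wgam_pos {γ : ℝ} (hγ : 1 < γ) : 0 < ∫ t in (-1:ℝ)..1, (wgam γ t)⁻¹ :=
  intervalIntegral.intervalIntegral_pos_of_pos_on (intervalIntegrable_inv_wgam hγ)
    (fun _ ht => inv_pos.2 (wgam_pos ht)) (by norm_num)

lemma bgam_pos {γ : ℝ} (hγ : 1 < γ) : 0 < bgam γ := div_pos two_pos (integral_inv_wgam_pos hγ)

lemma intervalIntegrable_inv_wgam_of_mem {γ : ℝ} (hγ : 1 < γ) {x y : ℝ} (hx : x ∈ Icc (-1:ℝ) 1)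
    (hy : y ∈ Icc (-1:ℝ) 1) : IntervalIntegrable (fun t => (wgam γ t)⁻¹) volume x y := by
  refine (intervalIntegrable_inv_wgam hγ).mono_set ?_
  rw [uIcc_of_le (by norm_num : (-1:ℝ) ≤ 1)]
  exact (ordConnected_Icc.uIcc_subset hx hy)

lemma hgam_neg_one (γ : ℝ) : hgam γ (-1) = -1 := by simp [hgam_eq]

lemma hgam_one {γ : ℝ} (hγ : 1 < γ) : hgam γ 1 = 1 := by
  rw [hgam_eq, bgam, div_mul_cancel₀ _ (integral_inv_wgam_pos hγ).ne']
  norm_num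

lemma hgam_neg {γ : ℝ} (hγ : 1 < γ) {x : ℝ} (hx : x ∈ Icc (-1:ℝ) 1) :
    hgam γ (-x) = -hgam γ x := by
  have hneg : ∫ t in (-1:ℝ)..(-x), (wgam γ t)⁻¹ = ∫ t in x..1, (wgam γ t)⁻¹ := by
    have := intervalIntegral.integral_comp_neg (fun t => (wgam γ t)⁻¹) (a := x) (b := 1)
    simp only [wgam_neg] at this
    exact this.symm
  have hadd := intervalIntegral.integral_add_adjacent_intervals
    (intervalIntegrable_inv_wgam_of_mem hγ (left_mem_Icc.2 (by norm_num)) hx)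
    (intervalIntegrable_inv_wgam_of_mem hγ hx (right_mem_Icc.2 (by norm_num)))
  have hone := hgam_one hγ
  rw [hgam_eq, ← hadd, mul_add] at hone
  rw [hgam_eq, hgam_eq, hneg]
  linarith

lemma hgam_zero {γ : ℝ} (hγ : 1 < γ) : hgam γ 0 = 0 := by
  have := hgam_neg hγ (x := 0) (by norm_num)
  rw [neg_zero] at this
  linarith

lemma hasDerivAt_hgam {γ : ℝ} (hγ : 1 < γ) {x : ℝ} (hx : x ∈ Ioo (-1:ℝ) 1) :
    HasDerivAt (hgam γ) (bgam γ * (wgam γ x)⁻¹) x := by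
  have hc := continuous_wgam hγ
  have h := intervalIntegral.integral_hasDerivAt_right
    (intervalIntegrable_inv_wgam_of_mem hγ (left_mem_Icc.2 (by norm_num))
      (Ioo_subset_Icc_self hx))
    (hc.measurable.inv.stronglyMeasurable.stronglyMeasurableAtFilter)
    (hc.continuousAt.inv₀ (wgam_pos hx).ne')
  exact (h.const_mul (bgam γ)).const_add (-1)

lemma continuousOn_hgam {γ : ℝ} (hγ : 1 < γ) : ContinuousOn (hgam γ) (Icc (-1) 1) := by
  have h : ContinuousOn (fun x => ∫ t in (-1:ℝ)..x, (wgam γ t)⁻¹) (uIcc (-1) 1) :=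
    intervalIntegral.continuousOn_primitive_interval
      ((intervalIntegrable_iff').1 (intervalIntegrable_inv_wgam hγ))
  rw [uIcc_of_le (by norm_num)] at h
  exact continuousOn_const.add (continuousOn_const.mul h)

lemma strictMonoOn_hgam {γ : ℝ} (hγ : 1 < γ) : StrictMonoOn (hgam γ) (Icc (-1) 1) := by
  refine strictMonoOn_of_deriv_pos (convex_Icc _ _) (continuousOn_hgam hγ) fun x hx => ?_
  rw [interior_Icc] at hx
  rw [(hasDerivAt_hgam hγ hx).deriv]
  exact mul_pos (bgam_pos hγ) (inv_pos.2 (wgam_pos hx))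

lemma image_hgam {γ : ℝ} (hγ : 1 < γ) : hgam γ '' Icc (-1) 1 = Icc (-1) 1 := by
  rw [(continuousOn_hgam hγ).image_Icc_of_monotoneOn (by norm_num) (strictMonoOn_hgam hγ).monotoneOn,
    hgam_neg_one, hgam_one hγ]

lemma hgam_mem_Icc {γ : ℝ} (hγ : 1 < γ) {x : ℝ} (hx : x ∈ Icc (-1:ℝ) 1) :
    hgam γ x ∈ Icc (-1:ℝ) 1 := image_hgam hγ ▸ mem_image_of_mem _ hx

lemma hgamInv_hgam {γ : ℝ} (hγ : 1 < γ) {x : ℝ} (hx : x ∈ Icc (-1:ℝ) 1) :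
    hgamInv γ (hgam γ x) = x := (strictMonoOn_hgam hγ).injOn.leftInvOn_invFunOn hx

lemma hgam_hgamInv {γ : ℝ} (hγ : 1 < γ) {y : ℝ} (hy : y ∈ Icc (-1:ℝ) 1) :
    hgam γ (hgamInv γ y) = y := Function.invFunOn_eq (by rwa [← image_hgam hγ] at hy)

lemma hgamInv_mem_Icc {γ : ℝ} (hγ : 1 < γ) {y : ℝ} (hy : y ∈ Icc (-1:ℝ) 1) :
    hgamInv γ y ∈ Icc (-1:ℝ) 1 := Function.invFunOn_mem (by rwa [← image_hgam hγ] at hy)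

lemma hgamInv_one {γ : ℝ} (hγ : 1 < γ) : hgamInv γ 1 = 1 := by
  simpa only [hgam_one hγ] using hgamInv_hgam hγ (x := 1) (by norm_num)

lemma hgamInv_neg_one {γ : ℝ} (hγ : 1 < γ) : hgamInv γ (-1) = -1 := by
  simpa only [hgam_neg_one] using hgamInv_hgam hγ (x := -1) (by norm_num)

lemma continuousOn_hgamInv {γ : ℝ} (hγ : 1 < γ) : ContinuousOn (hgamInv γ) (Icc (-1) 1) := by
  have := isCompact_Icc.continuousOn_invFunOn_image (continuousOn_hgam hγ)
    (strictMonoOn_hgam hγ).injOn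
  rwa [image_hgam hγ] at this

lemma hgamInv_mem_Ioo {γ : ℝ} (hγ : 1 < γ) {y : ℝ} (hy : y ∈ Ioo (-1:ℝ) 1) :
    hgamInv γ y ∈ Ioo (-1:ℝ) 1 := by
  have hy' := Ioo_subset_Icc_self hy
  have hinv := hgam_hgamInv hγ hy'
  obtain ⟨h1, h2⟩ := hgamInv_mem_Icc hγ hy'
  refine ⟨h1.lt_of_ne fun h => ?_, h2.lt_of_ne fun h => ?_⟩
  · rw [← h, hgam_neg_one] at hinv
    exact hy.1.ne hinv
  · rw [h, hgam_one hγ] at hinv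
    exact hy.2.ne hinv.symm

lemma hgam_mem_Ioo {γ : ℝ} (hγ : 1 < γ) {x : ℝ} (hx : x ∈ Ioo (-1:ℝ) 1) :
    hgam γ x ∈ Ioo (-1:ℝ) 1 := by
  have hmono := strictMonoOn_hgam hγ
  have hx' := Ioo_subset_Icc_self hx
  have h1 := hmono (left_mem_Icc.2 (by norm_num)) hx' hx.1
  have h2 := hmono hx' (right_mem_Icc.2 (by norm_num)) hx.2
  rw [hgam_neg_one] at h1
  rw [hgam_one hγ] at h2
  exact ⟨h1, h2⟩

lemma hasDerivAt_hgamInv {γ : ℝ} (hγ : 1 < γ) {y : ℝ} (hy : y ∈ Ioo (-1:ℝ) 1) :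
    HasDerivAt (hgamInv γ) (wgam γ (hgamInv γ y) / bgam γ) y := by
  have hmem := hgamInv_mem_Ioo hγ hy
  have h := HasDerivAt.of_local_left_inverse
    ((continuousOn_hgamInv hγ).continuousAt (Icc_mem_nhds hy.1 hy.2)) (hasDerivAt_hgam hγ hmem)
    (mul_pos (bgam_pos hγ) (inv_pos.2 (wgam_pos hmem))).ne'
    (by filter_upwards [Icc_mem_nhds hy.1 hy.2] with z hz using hgam_hgamInv hγ hz)
  exact h.congr_deriv (by rw [mul_inv, inv_inv]; ring)

lemma tendsto_wgam_div_hgam {γ : ℝ} (hγ : 1 < γ) :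
    ∃ c : ℝ, 0 < c ∧
      Tendsto (fun x => wgam γ x / (1 + hgam γ x) ^ (γ - 1)) (𝓝[>] (-1)) (𝓝 c) := by
  have hγ0 : 0 < γ := by linarith
  have hC : 0 < γ * bgam γ * (2 ^ ((γ - 1) / γ))⁻¹ := by
    have := bgam_pos hγ
    positivity
  have hIoo : Ioo (-1:ℝ) 1 ∈ 𝓝[>] (-1:ℝ) := Ioo_mem_nhdsGT (by norm_num)
  have hlim : Tendsto (fun x => (1 + hgam γ x) / (1 + x) ^ (1 / γ)) (𝓝[>] (-1))
      (𝓝 (γ * bgam γ * (2 ^ ((γ - 1) / γ))⁻¹)) := by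
    refine HasDerivAt.lhopital_zero_nhdsGT (f' := fun x => bgam γ * (wgam γ x)⁻¹)
      (g' := fun x => 1 / γ * (1 + x) ^ (1 / γ - 1)) ?_ ?_ ?_ ?_ ?_ ?_
    · filter_upwards [hIoo] with x hx using (hasDerivAt_hgam hγ hx).const_add 1
    · filter_upwards [hIoo] with x hx
      have := ((hasDerivAt_id x).const_add 1).rpow_const (p := 1 / γ)
        (Or.inl (by simp only [id]; linarith [hx.1]))
      exact this.congr_deriv (by rw [one_mul]; rfl)
    · filter_upwards [hIoo] with x hx
      have : 0 < 1 + x := by linarith [hx.1]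
      positivity
    · have h : Tendsto (hgam γ) (𝓝[Ioo (-1) 1] (-1)) (𝓝 (hgam γ (-1))) :=
        (continuousOn_hgam hγ (-1) (by norm_num)).mono Ioo_subset_Icc_self
      rw [nhdsWithin_Ioo_eq_nhdsGT (by norm_num), hgam_neg_one] at h
      simpa using h.const_add 1
    · have h : Continuous fun x : ℝ => (1 + x) ^ (1 / γ) :=
        (by fun_prop : Continuous fun x : ℝ => 1 + x).rpow_const fun _ => Or.inr (by positivity)
      have h' := (h.tendsto (-1)).mono_left (nhdsWithin_le_nhds (s := Ioi (-1)))
      have h0 : ((1:ℝ) + -1) ^ (1 / γ) = 0 := by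
        rw [add_neg_cancel, Real.zero_rpow (by positivity)]
      rwa [h0] at h'
    · have h : ContinuousAt (fun x : ℝ => γ * bgam γ * ((1 - x) ^ ((γ - 1) / γ))⁻¹) (-1) := by
        refine continuousAt_const.mul (ContinuousAt.inv₀ ?_ (by norm_num; positivity))
        exact ContinuousAt.rpow_const (by fun_prop) (Or.inl (by norm_num))
      have h' := h.tendsto.mono_left (nhdsWithin_le_nhds (s := Ioi (-1)))
      norm_num only [sub_neg_eq_add] at h'
      refine h'.congr' ?_
      filter_upwards [hIoo] with x hx
      have hx1 : 0 < 1 + x := by linarith [hx.1]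
      have hx2 : 0 < 1 - x := by linarith [hx.2]
      have he : 1 / γ - 1 = -((γ - 1) / γ) := by field_simp; ring
      rw [wgam_eq_mul (Ioo_subset_Icc_self hx), he, Real.rpow_neg hx1.le]
      field_simp
  have hpow := (hlim.rpow_const (p := γ - 1) (Or.inl hC.ne')).inv₀
    (Real.rpow_pos_of_pos hC _).ne'
  have hfac : Tendsto (fun x : ℝ => (1 - x) ^ ((γ - 1) / γ)) (𝓝[>] (-1))
      (𝓝 ((1 - (-1)) ^ ((γ - 1) / γ))) := by
    refine Tendsto.mono_left ?_ nhdsWithin_le_nhds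
    exact (ContinuousAt.rpow_const (by fun_prop) (Or.inl (by norm_num)) : ContinuousAt
      (fun x : ℝ => (1 - x) ^ ((γ - 1) / γ)) (-1))
  refine ⟨_, ?_, (hpow.mul hfac).congr' ?_⟩
  · have : (0:ℝ) < 1 - (-1) := by norm_num
    positivity
  · filter_upwards [hIoo] with x hx
    have hx1 : 0 < 1 + x := by linarith [hx.1]
    have hh : 0 < 1 + hgam γ x := by linarith [(hgam_mem_Ioo hγ hx).1]
    rw [wgam_eq_mul (Ioo_subset_Icc_self hx), Real.div_rpow hh.le (by positivity),
      ← Real.rpow_mul hx1.le, inv_div, one_div_mul_eq_div]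
    ring

lemma hgamInv_neg {γ : ℝ} (hγ : 1 < γ) {y : ℝ} (hy : y ∈ Icc (-1:ℝ) 1) :
    hgamInv γ (-y) = -hgamInv γ y := by
  have hmem := hgamInv_mem_Icc hγ hy
  conv_lhs => rw [← hgam_hgamInv hγ hy, ← hgam_neg hγ hmem]
  exact hgamInv_hgam hγ ⟨by linarith [hmem.2], by linarith [hmem.1]⟩

lemma tendsto_hgam_nhdsGT_neg_one {γ : ℝ} (hγ : 1 < γ) :
    Tendsto (hgam γ) (𝓝[>] (-1)) (𝓝[>] (-1)) := by
  have h : Tendsto (hgam γ) (𝓝[Ioo (-1) 1] (-1)) (𝓝 (hgam γ (-1))) :=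
    (continuousOn_hgam hγ (-1) (by norm_num)).mono Ioo_subset_Icc_self
  rw [nhdsWithin_Ioo_eq_nhdsGT (by norm_num), hgam_neg_one] at h
  refine tendsto_nhdsWithin_iff.2 ⟨h, ?_⟩
  filter_upwards [Ioo_mem_nhdsGT (show (-1:ℝ) < 1 by norm_num)] with x hx
  exact (hgam_mem_Ioo hγ hx).1

lemma tendsto_hgamInv_nhdsGT_neg_one {γ : ℝ} (hγ : 1 < γ) :
    Tendsto (hgamInv γ) (𝓝[>] (-1)) (𝓝[>] (-1)) := by
  have h : Tendsto (hgamInv γ) (𝓝[Ioo (-1) 1] (-1)) (𝓝 (hgamInv γ (-1))) :=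
    (continuousOn_hgamInv hγ (-1) (by norm_num)).mono Ioo_subset_Icc_self
  rw [nhdsWithin_Ioo_eq_nhdsGT (by norm_num), hgamInv_neg_one hγ] at h
  refine tendsto_nhdsWithin_iff.2 ⟨h, ?_⟩
  filter_upwards [Ioo_mem_nhdsGT (show (-1:ℝ) < 1 by norm_num)] with x hx
  exact (hgamInv_mem_Ioo hγ hx).1

lemma tendsto_wgam_hgamInv_div {γ : ℝ} (hγ : 1 < γ) :
    ∃ c : ℝ, 0 < c ∧
      Tendsto (fun y => wgam γ (hgamInv γ y) / (1 + y) ^ (γ - 1)) (𝓝[>] (-1)) (𝓝 c) ∧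
      Tendsto (fun y => wgam γ (hgamInv γ y) / (1 - y) ^ (γ - 1)) (𝓝[<] 1) (𝓝 c) := by
  obtain ⟨c, hc, h⟩ := tendsto_wgam_div_hgam hγ
  have hleft : Tendsto (fun y => wgam γ (hgamInv γ y) / (1 + y) ^ (γ - 1)) (𝓝[>] (-1)) (𝓝 c) := by
    refine (h.comp (tendsto_hgamInv_nhdsGT_neg_one hγ)).congr' ?_
    filter_upwards [Ioo_mem_nhdsGT (show (-1:ℝ) < 1 by norm_num)] with y hy
    rw [Function.comp_apply, hgam_hgamInv hγ (Ioo_subset_Icc_self hy)]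
  refine ⟨c, hc, hleft, ?_⟩
  refine (hleft.comp (tendsto_neg_nhdsLT (a := (1:ℝ)))).congr' ?_
  filter_upwards [Ioo_mem_nhdsLT (show (-1:ℝ) < 1 by norm_num)] with y hy
  rw [Function.comp_apply, hgamInv_neg hγ (Ioo_subset_Icc_self hy), wgam_neg, ← sub_eq_add_neg]

lemma tendsto_wgam_conj_div_wgam {γ m : ℝ} (hγ : 1 < γ) {F : ℝ → ℝ} (hm : 0 < m)
    (hF : HasDerivWithinAt F m (Ioi (-1)) (-1)) (hF1 : F (-1) = -1)
    (hFmem : ∀ᶠ y in 𝓝[>] (-1), F y ∈ Ioo (-1) 1) :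
    Tendsto (fun x => wgam γ (hgamInv γ (F (hgam γ x))) / wgam γ x) (𝓝[>] (-1))
      (𝓝 (m ^ (γ - 1))) := by
  obtain ⟨c, hc, h, -⟩ := tendsto_wgam_hgamInv_div hγ
  have hFt : Tendsto F (𝓝[>] (-1)) (𝓝[>] (-1)) := by
    refine tendsto_nhdsWithin_iff.2 ⟨?_, hFmem.mono fun y hy => hy.1⟩
    have := hF.continuousWithinAt.tendsto
    rwa [hF1] at this
  have hslope := ((hasDerivWithinAt_iff_tendsto_slope' self_notMem_Ioi).1 hF).rpow_const
    (p := γ - 1) (Or.inl hm.ne')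
  have hy := (((h.comp hFt).div h hc.ne').mul hslope).comp (tendsto_hgam_nhdsGT_neg_one hγ)
  rw [div_self hc.ne', one_mul] at hy
  refine hy.congr' ?_
  filter_upwards [Ioo_mem_nhdsGT (show (-1:ℝ) < 1 by norm_num),
    (tendsto_hgam_nhdsGT_neg_one hγ).eventually hFmem] with x hx hFx
  have h1 : 0 < 1 + hgam γ x := by linarith [(hgam_mem_Ioo hγ hx).1]
  have h2 : 0 < 1 + F (hgam γ x) := by linarith [hFx.1]
  have h3 := wgam_pos (γ := γ) hx
  simp only [Function.comp_apply, Pi.div_apply, slope_def_field, hF1, sub_neg_eq_add,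
    hgamInv_hgam hγ (Ioo_subset_Icc_self hx)]
  rw [add_comm (F _) 1, add_comm (hgam γ x) 1, Real.div_rpow h2.le h1.le]
  have := Real.rpow_pos_of_pos h1 (γ - 1)
  have := Real.rpow_pos_of_pos h2 (γ - 1)
  field_simp

lemma tendsto_wgam_conj_div_abs_rpow {γ m : ℝ} (hγ : 1 < γ) {F : ℝ → ℝ} (hm : 0 < m)
    (hF : HasDerivWithinAt F m (Iio 0) 0) (hF0 : F 0 = 1)
    (hFmem : ∀ᶠ y in 𝓝[<] 0, F y ∈ Ioo (-1) 1) :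
    ∃ A : ℝ, 0 < A ∧
      Tendsto (fun x => wgam γ (hgamInv γ (F (hgam γ x))) / |x| ^ (γ - 1)) (𝓝[<] 0) (𝓝 A) := by
  obtain ⟨c, hc, -, h⟩ := tendsto_wgam_hgamInv_div hγ
  have hb := bgam_pos hγ
  have hh : HasDerivAt (hgam γ) (bgam γ) 0 := by
    simpa [wgam_zero] using hasDerivAt_hgam hγ (x := 0) (by norm_num)
  have hht : Tendsto (hgam γ) (𝓝[<] 0) (𝓝[<] 0) := by
    refine tendsto_nhdsWithin_iff.2 ⟨?_, ?_⟩
    · have := hh.continuousAt.tendsto.mono_left (nhdsWithin_le_nhds (s := Iio 0))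
      rwa [hgam_zero hγ] at this
    · filter_upwards [Ioo_mem_nhdsLT (show (-1:ℝ) < 0 by norm_num)] with x hx
      have := strictMonoOn_hgam hγ ⟨hx.1.le, by linarith [hx.2]⟩ (by norm_num) hx.2
      rwa [hgam_zero hγ] at this
  have hFt : Tendsto F (𝓝[<] 0) (𝓝[<] 1) := by
    refine tendsto_nhdsWithin_iff.2 ⟨?_, hFmem.mono fun y hy => hy.2⟩
    have := hF.continuousWithinAt.tendsto
    rwa [hF0] at this
  have hFs := ((hasDerivWithinAt_iff_tendsto_slope' self_notMem_Iio).1 hF).comp hht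
  have hhs := (hasDerivWithinAt_iff_tendsto_slope' self_notMem_Iio).1
    (hh.hasDerivWithinAt (s := Iio 0))
  have hs := (hFs.mul hhs).rpow_const (p := γ - 1) (Or.inl (mul_pos hm hb).ne')
  refine ⟨_, mul_pos hc (Real.rpow_pos_of_pos (mul_pos hm hb) (γ - 1)),
    ((h.comp (hFt.comp hht)).mul hs).congr' ?_⟩
  filter_upwards [self_mem_nhdsWithin, hht self_mem_nhdsWithin, hht.eventually hFmem]
    with x hx hhx hFx
  have h1 : 0 < 1 - F (hgam γ x) := by linarith [hFx.2]
  have hx' : 0 < |x| := abs_pos.2 (ne_of_lt hx)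
  have hhx' : hgam γ x ≠ 0 := ne_of_lt hhx
  have hxne : x ≠ 0 := ne_of_lt hx
  have he : slope F 0 (hgam γ x) * slope (hgam γ) 0 x = (1 - F (hgam γ x)) / |x| := by
    rw [slope_def_field, slope_def_field, hF0, hgam_zero hγ, abs_of_neg hx]
    field_simp
    ring
  simp only [Function.comp_apply]
  rw [he, Real.div_rpow h1.le hx'.le]
  have := Real.rpow_pos_of_pos h1 (γ - 1)
  have := Real.rpow_pos_of_pos hx' (γ - 1)
  field_simp

lemma pos_of_strictMonoOn_of_hasDerivWithinAt {a b x m : ℝ} {F : ℝ → ℝ} (hab : a < b)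
    (hF : StrictMonoOn F (Icc a b)) (hx : x ∈ Icc a b) (hd : HasDerivWithinAt F m (Icc a b) x)
    (hm : m ≠ 0) : 0 < m := by
  have h := hF.monotoneOn.derivWithin_nonneg (x := x)
  rw [hd.derivWithin (uniqueDiffOn_Icc hab x hx)] at h
  exact h.lt_of_ne' hm

/-- The left half of the main statement, for the restriction of the map to `[-1, 0]`. -/
lemma conj_hgam_power_law_left {γ : ℝ} (hγ : 1 < γ) {F d : ℝ → ℝ}
    (hmono : StrictMonoOn F (Icc (-1) 0)) (hF1 : F (-1) = -1) (hF0 : F 0 = 1)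
    (hd : ∀ x ∈ Icc (-1:ℝ) 0, HasDerivWithinAt F (d x) (Icc (-1) 0) x)
    (hdc : ContinuousOn d (Icc (-1) 0)) (hpos : ∀ x ∈ Icc (-1:ℝ) 0, 0 < d x) :
    ∃ fd : ℝ → ℝ,
      (∀ x ∈ Icc (-1:ℝ) 0, HasDerivWithinAt (hgamInv γ ∘ F ∘ hgam γ) (fd x) (Icc (-1) 0) x) ∧
      ContinuousOn fd (Icc (-1) 0) ∧ fd 0 = 0 ∧
      (∃ A : ℝ, A ≠ 0 ∧ Tendsto (fun x => fd x / |x| ^ (γ - 1)) (𝓝[<] 0) (𝓝 A)) ∧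
      fd (-1) = d (-1) ^ γ := by
  have hl : (-1:ℝ) ∈ Icc (-1:ℝ) 0 := by norm_num
  have hr : (0:ℝ) ∈ Icc (-1:ℝ) 0 := by norm_num
  have hsub : Icc (-1:ℝ) 0 ⊆ Icc (-1) 1 := Icc_subset_Icc_right (by norm_num)
  have hsub' : Ioo (-1:ℝ) 0 ⊆ Ioo (-1) 1 := Ioo_subset_Ioo_right (by norm_num)
  have hhI : MapsTo (hgam γ) (Icc (-1) 0) (Icc (-1) 0) := fun x hx =>
    ⟨(hgam_mem_Icc hγ (hsub hx)).1, by
      simpa [hgam_zero hγ] using (strictMonoOn_hgam hγ).monotoneOn (hsub hx) (hsub hr) hx.2⟩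
  have hhO : MapsTo (hgam γ) (Ioo (-1) 0) (Ioo (-1) 0) := fun x hx =>
    ⟨(hgam_mem_Ioo hγ (hsub' hx)).1, by
      simpa [hgam_zero hγ] using
        strictMonoOn_hgam hγ (hsub (Ioo_subset_Icc_self hx)) (hsub hr) hx.2⟩
  have hFI : MapsTo F (Icc (-1) 0) (Icc (-1) 1) := fun y hy =>
    ⟨hF1 ▸ hmono.monotoneOn hl hy hy.1, hF0 ▸ hmono.monotoneOn hy hr hy.2⟩
  have hFO : MapsTo F (Ioo (-1) 0) (Ioo (-1) 1) := fun y hy =>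
    ⟨hF1 ▸ hmono hl (Ioo_subset_Icc_self hy) hy.1, hF0 ▸ hmono (Ioo_subset_Icc_self hy) hr hy.2⟩
  have hFc : ContinuousOn F (Icc (-1) 0) := fun y hy => (hd y hy).continuousWithinAt
  have hhc : ContinuousOn (hgam γ) (Icc (-1) 0) := (continuousOn_hgam hγ).mono hsub
  have hfc : ContinuousOn (hgamInv γ ∘ F ∘ hgam γ) (Icc (-1) 0) :=
    (continuousOn_hgamInv hγ).comp (hFc.comp hhc hhI) (hFI.comp hhI)
  have hdhc : ContinuousOn (fun x => d (hgam γ x)) (Icc (-1) 0) := hdc.comp hhc hhI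
  have hderiv : ∀ x ∈ Ioo (-1:ℝ) 0, HasDerivAt (hgamInv γ ∘ F ∘ hgam γ)
      (d (hgam γ x) * (wgam γ (hgamInv γ (F (hgam γ x))) / wgam γ x)) x := by
    intro x hx
    have hy := hhO hx
    have hFd := (hd _ (Ioo_subset_Icc_self hy)).hasDerivAt (Icc_mem_nhds hy.1 hy.2)
    have := (hasDerivAt_hgamInv hγ (hFO hy)).comp x (hFd.comp x (hasDerivAt_hgam hγ (hsub' hx)))
    refine this.congr_deriv ?_
    have := bgam_pos hγ
    have := wgam_pos (γ := γ) (hsub' hx)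
    field_simp
  let fd : ℝ → ℝ := fun x => if x = -1 then d (-1) ^ γ else
    d (hgam γ x) * (wgam γ (hgamInv γ (F (hgam γ x))) / wgam γ x)
  have hfd : ∀ x, x ≠ -1 →
      fd x = d (hgam γ x) * (wgam γ (hgamInv γ (F (hgam γ x))) / wgam γ x) := fun x hx => if_neg hx
  have hfd1 : fd (-1) = d (-1) ^ γ := if_pos rfl
  have hfdc : ContinuousOn fd (Icc (-1) 0) := by
    intro x hx
    rcases eq_or_lt_of_le hx.1 with rfl | hx1
    · have hFmem : ∀ᶠ y in 𝓝[>] (-1), F y ∈ Ioo (-1) 1 := by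
        filter_upwards [Ioo_mem_nhdsGT (show (-1:ℝ) < 0 by norm_num)] with y hy using hFO hy
      have hFd : HasDerivWithinAt F (d (-1)) (Ioi (-1)) (-1) :=
        (hd _ hl).mono_of_mem_nhdsWithin (Icc_mem_nhdsGT (by norm_num))
      have h1 := tendsto_wgam_conj_div_wgam hγ (hpos _ hl) hFd hF1 hFmem
      have h2 : Tendsto (fun x => d (hgam γ x)) (𝓝[Ioc (-1) 0] (-1)) (𝓝 (d (hgam γ (-1)))) :=
        (hdhc _ hl).mono Ioc_subset_Icc_self
      rw [nhdsWithin_Ioc_eq_nhdsGT (by norm_num), hgam_neg_one] at h2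
      have h3 := h2.mul h1
      rw [← Real.rpow_one_add' (hpos _ hl).le (by linarith), add_sub_cancel, ← hfd1] at h3
      rw [← Ioc_insert_left (show (-1:ℝ) ≤ 0 by norm_num), continuousWithinAt_insert_self,
        ContinuousWithinAt, nhdsWithin_Ioc_eq_nhdsGT (by norm_num)]
      refine h3.congr' ?_
      filter_upwards [self_mem_nhdsWithin] with x hx using (hfd x (ne_of_gt hx)).symm
    · have hw : wgam γ x ≠ 0 := (wgam_pos ⟨hx1, by linarith [hx.2]⟩).ne'
      have h : ContinuousWithinAt (fun x => d (hgam γ x) *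
          (wgam γ (hgamInv γ (F (hgam γ x))) / wgam γ x)) (Icc (-1) 0) x :=
        (hdhc x hx).mul (((continuous_wgam hγ).continuousAt.comp_continuousWithinAt (hfc x hx)).div
          (continuous_wgam hγ).continuousWithinAt hw)
      refine h.congr_of_eventuallyEq ?_ (hfd x hx1.ne')
      filter_upwards [nhdsWithin_le_nhds (eventually_ne_nhds hx1.ne')] with z hz using hfd z hz
  refine ⟨fd, hasDerivWithinAt_Icc_of_continuousOn (by norm_num) hfc hfdc fun x hx => ?_, hfdc, ?_,
    ?_, hfd1⟩
  · rw [hfd x hx.1.ne']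
    exact hderiv x hx
  · rw [hfd 0 (by norm_num), hgam_zero hγ, hF0, hgamInv_one hγ, wgam_one hγ]
    simp
  · have hFmem : ∀ᶠ y in 𝓝[<] 0, F y ∈ Ioo (-1) 1 := by
      filter_upwards [Ioo_mem_nhdsLT (show (-1:ℝ) < 0 by norm_num)] with y hy using hFO hy
    have hFd : HasDerivWithinAt F (d 0) (Iio 0) 0 :=
      (hd _ hr).mono_of_mem_nhdsWithin (Icc_mem_nhdsLT (by norm_num))
    obtain ⟨A, hA, h1⟩ := tendsto_wgam_conj_div_abs_rpow hγ (hpos _ hr) hFd hF0 hFmem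
    have h2 : Tendsto (fun x => d (hgam γ x)) (𝓝[Ico (-1) 0] 0) (𝓝 (d (hgam γ 0))) :=
      (hdhc _ hr).mono Ico_subset_Icc_self
    rw [nhdsWithin_Ico_eq_nhdsLT (by norm_num), hgam_zero hγ] at h2
    have h3 : Tendsto (wgam γ) (𝓝[<] 0) (𝓝 (wgam γ 0)) :=
      ((continuous_wgam hγ).tendsto 0).mono_left nhdsWithin_le_nhds
    rw [wgam_zero] at h3
    refine ⟨_, ?_, ((h2.mul h1).div h3 one_ne_zero).congr' ?_⟩
    · rw [div_one]
      exact (mul_pos (hpos _ hr) hA).ne'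
    · filter_upwards [Ioo_mem_nhdsLT (show (-1:ℝ) < 0 by norm_num)] with x hx
      rw [Pi.div_apply, hfd x hx.1.ne']
      ring

/-- Lemma 2: if `f̃` is a continuous self-map of `[-1,1]` with unique
turning point `0`, mapping `0 ↦ 1` and `±1 ↦ -1`, whose restrictions to `[-1,0]` and `[0,1]`
are C¹-embeddings, then for any `γ > 1` the map `f = h_γ⁻¹ ∘ f̃ ∘ h_γ` is a C¹ self-map of
`[-1,1]` with power law `|x|^γ` at `0`, and `f'(-1) = (f̃'(-1))^γ`, `f'(1) = -|f̃'(1)|^γ`. -/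
theorem pullback_of_C1_embedding_has_power_law (γ : ℝ) (hγ : 1 < γ) (ft d0 d1 : ℝ → ℝ)
    (hcont : ContinuousOn ft (Icc (-1) 1))
    (hmaps : MapsTo ft (Icc (-1) 1) (Icc (-1) 1))
    (hmono : StrictMonoOn ft (Icc (-1) 0)) (hanti : StrictAntiOn ft (Icc 0 1))
    (hft0 : ft 0 = 1) (hftm1 : ft (-1) = -1) (hft1 : ft 1 = -1)
    (hd0 : ∀ x ∈ Icc (-1:ℝ) 0, HasDerivWithinAt ft (d0 x) (Icc (-1) 0) x)
    (hd0c : ContinuousOn d0 (Icc (-1) 0)) (hd0ne : ∀ x ∈ Icc (-1:ℝ) 0, d0 x ≠ 0)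
    (hd1 : ∀ x ∈ Icc (0:ℝ) 1, HasDerivWithinAt ft (d1 x) (Icc 0 1) x)
    (hd1c : ContinuousOn d1 (Icc 0 1)) (hd1ne : ∀ x ∈ Icc (0:ℝ) 1, d1 x ≠ 0) :
    MapsTo (hgamInv γ ∘ ft ∘ hgam γ) (Icc (-1) 1) (Icc (-1) 1) ∧
    ∃ fd : ℝ → ℝ,
      (∀ x ∈ Icc (-1:ℝ) 1,
        HasDerivWithinAt (hgamInv γ ∘ ft ∘ hgam γ) (fd x) (Icc (-1) 1) x) ∧
      ContinuousOn fd (Icc (-1) 1) ∧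
      (∃ A : ℝ, A ≠ 0 ∧
        Tendsto (fun x => fd x / |x| ^ (γ - 1)) (nhdsWithin 0 (Iio 0)) (nhds A)) ∧
      (∃ B : ℝ, B ≠ 0 ∧
        Tendsto (fun x => fd x / |x| ^ (γ - 1)) (nhdsWithin 0 (Ioi 0)) (nhds B)) ∧
      fd (-1) = (d0 (-1)) ^ γ ∧ fd 1 = -(|d1 1| ^ γ) := by
  have hposl : ∀ x ∈ Icc (-1:ℝ) 0, 0 < d0 x := fun x hx =>
    pos_of_strictMonoOn_of_hasDerivWithinAt (by norm_num) hmono hx (hd0 x hx) (hd0ne x hx)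
  have hneg : MapsTo (fun x : ℝ => -x) (Icc (-1) 0) (Icc 0 1) := fun x hx =>
    ⟨by linarith [hx.2], by linarith [hx.1]⟩
  have hneg' : MapsTo (fun x : ℝ => -x) (Icc 0 1) (Icc (-1) 0) := fun x hx =>
    ⟨by linarith [hx.2], by linarith [hx.1]⟩
  have hmono' : StrictMonoOn (fun y => ft (-y)) (Icc (-1) 0) := fun x hx y hy hxy =>
    hanti (hneg hy) (hneg hx) (neg_lt_neg hxy)
  have hd1' : ∀ x ∈ Icc (-1:ℝ) 0,
      HasDerivWithinAt (fun y => ft (-y)) (-d1 (-x)) (Icc (-1) 0) x := fun x hx =>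
    ((hd1 _ (hneg hx)).comp x (hasDerivWithinAt_neg x _) hneg).congr_deriv (mul_neg_one _)
  have hposr : ∀ x ∈ Icc (-1:ℝ) 0, 0 < -d1 (-x) := fun x hx =>
    pos_of_strictMonoOn_of_hasDerivWithinAt (by norm_num) hmono' hx (hd1' x hx)
      (neg_ne_zero.2 (hd1ne _ (hneg hx)))
  obtain ⟨fl, hfl, hflc, hfl0, ⟨A, hA, hAlim⟩, hfl1⟩ :=
    conj_hgam_power_law_left hγ hmono hftm1 hft0 hd0 hd0c hposl
  obtain ⟨fr, hfr, hfrc, hfr0, ⟨B, hB, hBlim⟩, hfr1⟩ :=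
    conj_hgam_power_law_left hγ hmono' (by simpa using hft1) (by simpa using hft0) hd1'
      (hd1c.comp continuousOn_neg hneg).neg hposr
  have hfr' : ∀ x ∈ Icc (0:ℝ) 1,
      HasDerivWithinAt (hgamInv γ ∘ ft ∘ hgam γ) (-fr (-x)) (Icc 0 1) x := by
    intro x hx
    have h := ((hfr _ (hneg' hx)).comp x (hasDerivWithinAt_neg x _) hneg').congr_deriv
      (mul_neg_one _)
    have hsymm : ∀ y ∈ Icc (0:ℝ) 1, (hgamInv γ ∘ ft ∘ hgam γ) y =
        ((hgamInv γ ∘ (fun y => ft (-y)) ∘ hgam γ) ∘ fun x => -x) y := by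
      intro y hy
      simp only [Function.comp_apply]
      rw [hgam_neg hγ ⟨by linarith [hy.1], hy.2⟩, neg_neg]
    exact h.congr hsymm (hsymm x hx)
  have hunion : Icc (-1:ℝ) 0 ∪ Icc 0 1 = Icc (-1) 1 :=
    Icc_union_Icc_eq_Icc (by norm_num) (by norm_num)
  let fd : ℝ → ℝ := fun x => if x ≤ 0 then fl x else -fr (-x)
  have hfdl : EqOn fd fl (Icc (-1) 0) := fun x hx => if_pos hx.2
  have hfdr : EqOn fd (fun x => -fr (-x)) (Icc 0 1) := by
    intro x hx
    rcases eq_or_lt_of_le hx.1 with rfl | hx0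
    · simp [fd, hfl0, hfr0]
    · exact if_neg hx0.not_ge
  refine ⟨fun x hx => hgamInv_mem_Icc hγ (hmaps (hgam_mem_Icc hγ hx)), fd, ?_, ?_,
    ⟨A, hA, ?_⟩, ⟨-B, neg_ne_zero.2 hB, ?_⟩, ?_, ?_⟩
  · intro x hx
    rw [← hunion]
    refine HasDerivWithinAt.union ?_ ?_
    · by_cases hxl : x ∈ Icc (-1:ℝ) 0
      · exact (hfl x hxl).congr_deriv (hfdl hxl).symm
      · exact HasFDerivWithinAt.of_notMem_closure (by rwa [closure_Icc])
    · by_cases hxr : x ∈ Icc (0:ℝ) 1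
      · exact (hfr' x hxr).congr_deriv (hfdr hxr).symm
      · exact HasFDerivWithinAt.of_notMem_closure (by rwa [closure_Icc])
  · rw [← hunion]
    exact (hflc.congr hfdl).union_of_isClosed
      ((hfrc.comp continuousOn_neg hneg').neg.congr hfdr) isClosed_Icc isClosed_Icc
  · refine hAlim.congr' ?_
    filter_upwards [Ioo_mem_nhdsLT (show (-1:ℝ) < 0 by norm_num)] with x hx
    rw [hfdl (Ioo_subset_Icc_self hx)]
  · have h := (hBlim.comp (neg_zero (G := ℝ) ▸ tendsto_neg_nhdsGT (a := (0:ℝ)))).neg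
    refine h.congr' ?_
    filter_upwards [Ioo_mem_nhdsGT (show (0:ℝ) < 1 by norm_num)] with x hx
    rw [hfdr (Ioo_subset_Icc_self hx), Function.comp_apply, abs_neg, neg_div]
  · rw [hfdl (by norm_num), hfl1]
  · have h1 := hposr (-1) (by norm_num)
    rw [neg_neg] at h1 hfr1
    rw [hfdr (by norm_num)]
    dsimp only
    rw [hfr1, abs_of_neg (neg_pos.1 h1)]
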